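/- Let n ≥ 2 and let A be a nonsingular n×n 0–1 matrix such that A⁻¹ is equimodular. Then det(A) is an even integer. -/

import Mathlib

open Matrix Finset

/-- If any two entries of the adjugate of an integer matrix of size at least two agree up to sign,
then the determinant is even. -/
theorem two_dvd_det_of_adjugate_equimodular {n : ℕ} (hn : 2 ≤ n) (B : Matrix (Fin n) (Fin n) ℤ)
    (h : ∀ i j k l, B.adjugate i j = B.adjugate k l ∨ B.adjugate i j = -B.adjugate k l) :
    2 ∣ B.det := by
  have hdet : ((Int.castRingHom (ZMod 2)).mapMatrix B.adjugate).det = 0 := by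
    refine Matrix.det_zero_of_row_eq (i := ⟨0, by omega⟩) (j := ⟨1, by omega⟩) (by simp) ?_
    funext j
    rcases h ⟨0, by omega⟩ j ⟨1, by omega⟩ j with h | h <;> simp [h, ZMod.neg_eq_self_mod_two]
  rw [← RingHom.map_det, Matrix.det_adjugate, map_pow] at hdet
  exact (ZMod.intCast_zmod_eq_zero_iff_dvd _ 2).mp (eq_zero_of_pow_eq_zero hdet)

theorem stmt4 {n : ℕ} (hn : 2 ≤ n) (A : Matrix (Fin n) (Fin n) ℝ)
    (hA : IsUnit A.det)
    (h01 : ∀ i j, A i j = 0 ∨ A i j = 1)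
    (hequi : ∃ α : ℝ, ∀ i j, A⁻¹ i j = α ∨ A⁻¹ i j = -α) :
    ∃ m : ℤ, A.det = 2 * (m : ℝ) := by
  obtain ⟨α, hα⟩ := hequi
  have hint : ∀ i j, ∃ b : ℤ, (b : ℝ) = A i j := fun i j => by
    rcases h01 i j with h | h
    · exact ⟨0, by simp [h]⟩
    · exact ⟨1, by simp [h]⟩
  choose b hb using hint
  set B : Matrix (Fin n) (Fin n) ℤ := Matrix.of b
  have hBA : (Int.castRingHom ℝ).mapMatrix B = A := by
    ext i j
    simp [B, hb]
  have hdet : (B.det : ℝ) = A.det := by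
    rw [← hBA, ← RingHom.map_det]
    rfl
  have hadj : ∀ i j, (B.adjugate i j : ℝ) = A.det * A⁻¹ i j := fun i j => by
    have h : A.adjugate = A.det • A⁻¹ := by
      rw [Matrix.inv_def, smul_smul, Ring.mul_inverse_cancel _ hA, one_smul]
    rw [← smul_eq_mul, ← Matrix.smul_apply, ← h, ← hBA, ← RingHom.map_adjugate]
    rfl
  obtain ⟨m, hm⟩ := two_dvd_det_of_adjugate_equimodular hn B fun i j k l => by
    have h : (B.adjugate i j : ℝ) = B.adjugate k l ∨
        (B.adjugate i j : ℝ) = -B.adjugate k l := by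
      rw [hadj, hadj]
      rcases hα i j with h | h <;> rcases hα k l with h' | h' <;> simp [h, h']
    exact_mod_cast h
  exact ⟨m, by rw [← hdet, hm]; push_cast; rfl⟩
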